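/- arXiv:2209.08089 — 3 statements merged into one kernel-verified Lean document; each statement's English description precedes it below -/
import Mathlib

section
/- Let G be a finite group and let x ∈ G be a nonvanishing element of G. Then |C_G(x)| ≥ k(G), where C_G(x) is the centralizer of x in G and k(G) is the number of conjugacy classes of G. -/
open CategoryTheory

/-- An element `x` of a finite group `G` is *nonvanishing* if `χ(x) ≠ 0` for every
irreducible complex character `χ` of `G`. -/
def IsNonvanishing {G : Type} [Group G] (x : G) : Prop :=
  ∀ V : FDRep ℂ G, Simple V → V.character x ≠ 0

/-- The set of irreducible characters over a field. -/
def IrrChars (K : Type) [Field K] (G : Type) [Group G] : Set (G → K) :=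
  {χ | ∃ V : FDRep K G, Simple V ∧ V.character = χ}

set_option linter.unusedSectionVars false

section
variable {K : Type} [Field K] [IsAlgClosed K] [CharZero K] {G : Type} [Group G] [Fintype G]

lemma mem_irr_of_rep {M : Type} [AddCommGroup M] [Module K M] [FiniteDimensional K M]
    (ρ : Representation K G M) (h : ∑ g, ρ.character g * ρ.character g⁻¹ = Nat.card G) :
    ρ.character ∈ IrrChars K G :=
  ⟨FDRep.of ρ, (FDRep.simple_iff_char_is_norm_one _).2 h, rfl⟩

lemma irr_norm {χ : G → K} (h : χ ∈ IrrChars K G) : ∑ g, χ g * χ g⁻¹ = Nat.card G := by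
  obtain ⟨V, hV, rfl⟩ := h
  exact (FDRep.simple_iff_char_is_norm_one V).1 hV

lemma irr_orth {χ ψ : G → K} (h : χ ∈ IrrChars K G) (h' : ψ ∈ IrrChars K G) (hne : χ ≠ ψ) :
    ∑ g, χ g * ψ g⁻¹ = 0 := by
  obtain ⟨V, hV, rfl⟩ := h
  obtain ⟨W, hW, rfl⟩ := h'
  have := invertibleOfNonzero (NeZero.ne (Nat.card G : K))
  have h := FDRep.char_orthonormal V W
  rw [if_neg (fun ⟨i⟩ => hne (FDRep.char_iso i))] at h
  simpa using h

lemma irr_conj {χ : G → K} (h : χ ∈ IrrChars K G) (g k : G) : χ (k * g * k⁻¹) = χ g := by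
  obtain ⟨V, hV, rfl⟩ := h
  exact V.char_conj g k

lemma irr_inv {χ : G → K} (h : χ ∈ IrrChars K G) : (fun g => χ g⁻¹) ∈ IrrChars K G := by
  have hn := irr_norm h
  obtain ⟨V, hV, rfl⟩ := h
  have : (fun g => V.character g⁻¹) = (Representation.dual V.ρ).character := by
    ext g; exact (V.char_dual g).symm
  rw [this]
  apply mem_irr_of_rep
  simp_rw [← this]
  simp_rw [inv_inv, ← hn, mul_comm]

lemma irr_map {L : Type} [Field L] [IsAlgClosed L] [CharZero L] (f : K →+* L)
    {χ : G → K} (h : χ ∈ IrrChars K G) : (fun g => f (χ g)) ∈ IrrChars L G := by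
  have hn := irr_norm h
  obtain ⟨V, hV, rfl⟩ := h
  let b := Module.finBasis K V
  let m : G →* Matrix (Fin (Module.finrank K V)) (Fin (Module.finrank K V)) L :=
    f.mapMatrix.toMonoidHom.comp ((LinearMap.toMatrixAlgEquiv b).toRingEquiv.toRingHom.toMonoidHom.comp V.ρ)
  let ρ : Representation L G (Fin (Module.finrank K V) → L) :=
    (Matrix.toLinAlgEquiv' : _ ≃ₐ[L] _).toRingEquiv.toRingHom.toMonoidHom.comp m
  have : (fun g => f (V.character g)) = ρ.character := by
    ext g
    have : ρ g = Matrix.toLin' (m g) := rfl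
    rw [Representation.character, this, Matrix.trace_toLin'_eq, FDRep.character,
      LinearMap.trace_eq_matrix_trace K b, AddMonoidHom.map_trace]
    rfl
  rw [this]
  apply mem_irr_of_rep
  simp_rw [← this, ← map_mul, ← map_sum, hn, map_natCast]

lemma irr_integral {χ : G → K} (h : χ ∈ IrrChars K G) (g : G) : IsIntegral ℤ (χ g) := by
  obtain ⟨V, hV, rfl⟩ := h
  rw [FDRep.character, Module.End.trace_eq_sum_roots_charpoly_of_splits (IsAlgClosed.splits _)]
  apply IsIntegral.multiset_sum
  intro μ hμ
  rw [Polynomial.mem_roots (LinearMap.charpoly_monic _).ne_zero,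
    ← Module.End.hasEigenvalue_iff_isRoot_charpoly] at hμ
  obtain ⟨v, hv⟩ := hμ.exists_hasEigenvector
  have h1 := hv.pow_apply (Fintype.card G)
  rw [← map_pow, pow_card_eq_one, map_one, Module.End.one_apply] at h1
  have h2 : μ ^ Fintype.card G = 1 := by
    by_contra hne
    apply hv.2
    have : (μ ^ Fintype.card G - 1) • v = 0 := by rw [sub_smul, ← h1, one_smul, sub_self]
    exact (smul_eq_zero.1 this).resolve_left (sub_ne_zero.2 hne)
  exact IsIntegral.of_pow Fintype.card_pos (h2 ▸ isIntegral_one)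

lemma irr_finite : (IrrChars K G).Finite := by
  have hli : LinearIndependent K (fun χ : IrrChars K G => (χ : G → K)) := by
    rw [linearIndependent_iff']
    intro s c hc i hi
    have h1 : ∑ g, (∑ j ∈ s, c j • (j : G → K)) g * (i : G → K) g⁻¹ = 0 := by
      rw [hc]; simp
    simp only [Finset.sum_apply, Pi.smul_apply, smul_eq_mul, Finset.sum_mul] at h1
    rw [Finset.sum_comm, Finset.sum_eq_single i] at h1
    · simp_rw [mul_assoc, ← Finset.mul_sum, irr_norm i.2] at h1
      exact (mul_eq_zero.1 h1).resolve_right (NeZero.ne _)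
    · intro j _ hj
      simp_rw [mul_assoc, ← Finset.mul_sum]
      rw [irr_orth j.2 i.2 (fun h => hj (Subtype.ext h)), mul_zero]
    · exact fun h => absurd hi h
  exact Set.finite_coe_iff.1 hli.finite


open MonoidAlgebra in
lemma irr_act_zero (f : G → K) (hf : ∀ g k, f (k * g * k⁻¹) = f g)
    (h0 : ∀ χ ∈ IrrChars K G, ∑ g, f g * χ g⁻¹ = 0)
    {M : Type} [AddCommGroup M] [Module K M] [FiniteDimensional K M]
    (ρ : Representation K G M) [ρ.IsIrreducible] :
    ∑ g, f g • ρ g⁻¹ = 0 := by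
  have := invertibleOfNonzero (NeZero.ne (Nat.card G : K))
  have hχ : ρ.character ∈ IrrChars K G := by
    apply mem_irr_of_rep
    have := Representation.char_orthonormal ρ ρ
    rw [if_pos ⟨Representation.Equiv.refl ρ⟩, inv_mul_eq_one₀ (NeZero.ne _)] at this
    exact this.symm
  have h1 := h0 _ hχ
  let T : M →ₗ[K] M := ∑ g, f g • ρ g⁻¹
  have hT : ∀ k, T ∘ₗ ρ k = ρ k ∘ₗ T := by
    intro k
    change (∑ g, f g • ρ g⁻¹) * ρ k = ρ k * (∑ g, f g • ρ g⁻¹)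
    rw [Finset.sum_mul, Finset.mul_sum]
    refine Fintype.sum_equiv (MulAut.conj k⁻¹).toEquiv _ _ fun g => ?_
    have : (MulAut.conj k⁻¹).toEquiv g = k⁻¹ * g * k⁻¹⁻¹ := rfl
    rw [this, hf, smul_mul_assoc, mul_smul_comm, ← map_mul, ← map_mul]
    congr 2
    group
  obtain ⟨c, hc⟩ := (Representation.IsIrreducible.algebraMap_intertwiningMap_bijective_of_isAlgClosed
    (ρ := ρ)).2 ⟨T, hT⟩
  have hc' : T = c • (1 : M →ₗ[K] M) := by
    have := congrArg (fun t => t.toLinearMap) hc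
    exact this.symm
  have htr : LinearMap.trace K M T = 0 := by
    simp only [T, map_sum, map_smul, smul_eq_mul]
    exact h1
  change T = 0
  rw [hc', map_smul, LinearMap.trace_one, smul_eq_mul] at htr
  rcases mul_eq_zero.1 htr with h | h
  · rw [hc', h, zero_smul]
  · have : Module.finrank K M = 0 := by exact_mod_cast h
    have := Module.finrank_zero_iff.1 this
    exact Subsingleton.elim _ _

lemma irr_act_zero' (f : G → K) (hf : ∀ g k, f (k * g * k⁻¹) = f g)
    (h0 : ∀ χ ∈ IrrChars K G, ∑ g, f g * χ g⁻¹ = 0)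
    (N : Type) [AddCommGroup N] [Module K N] [Module (MonoidAlgebra K G) N]
    [IsScalarTower K (MonoidAlgebra K G) N]
    [hN : IsSimpleModule (MonoidAlgebra K G) N] (m : N) :
    (∑ g, MonoidAlgebra.single g⁻¹ (f g) : MonoidAlgebra K G) • m = 0 := by
  let ρ : Representation K G N := Representation.ofModule' N
  have hρ : ρ.asAlgebraHom = Algebra.lsmul K K N := by
    simp only [ρ, Representation.ofModule', Representation.asAlgebraHom, Equiv.apply_symm_apply]
  let e : ρ.asModule ≃ₗ[MonoidAlgebra K G] N :=
    { ρ.asModuleEquiv with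
      map_smul' := fun r m => by
        have := ρ.asModuleEquiv_map_smul r m
        rw [hρ] at this
        exact this }
  have hirr : ρ.IsIrreducible :=
    (Representation.irreducible_iff_isSimpleModule_asModule ρ).2 (IsSimpleModule.congr e)
  have : FiniteDimensional K N := Module.Finite.trans (MonoidAlgebra K G) N
  have h := irr_act_zero f hf h0 ρ
  have h2 : ρ.asAlgebraHom (∑ g, MonoidAlgebra.single g⁻¹ (f g)) = 0 := by
    rw [← h]
    simp only [map_sum, Representation.asAlgebraHom_single]
  rw [hρ] at h2
  exact congrArg (fun t => t m) h2

open MonoidAlgebra in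
lemma irr_complete (f : G → K) (hf : ∀ g k, f (k * g * k⁻¹) = f g)
    (h0 : ∀ χ ∈ IrrChars K G, ∑ g, f g * χ g⁻¹ = 0) : f = 0 := by
  let z : MonoidAlgebra K G := ∑ g, MonoidAlgebra.single g⁻¹ (f g)
  have key : ∀ N : Submodule (MonoidAlgebra K G) (MonoidAlgebra K G),
      IsSimpleModule (MonoidAlgebra K G) N → ∀ m ∈ N, z * m = 0 := by
    intro N hN m hm
    exact congrArg Subtype.val (irr_act_zero' f hf h0 N ⟨m, hm⟩)
  have hz : z = 0 := by
    have : IsSemisimpleModule (MonoidAlgebra K G) (MonoidAlgebra K G) := inferInstance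
    have htop := IsSemisimpleModule.sSup_simples_eq_top (MonoidAlgebra K G) (MonoidAlgebra K G)
    have h1 : (1 : MonoidAlgebra K G) ∈
        sSup {m : Submodule (MonoidAlgebra K G) (MonoidAlgebra K G) |
          IsSimpleModule (MonoidAlgebra K G) m} := by rw [htop]; trivial
    rw [sSup_eq_iSup'] at h1
    have : z * 1 = 0 := by
      refine Submodule.iSup_induction _ (motive := fun m => z * m = 0) h1 ?_ (mul_zero _) ?_
      · intro N m hm
        exact key N N.2 m hm
      · intro a b ha hb
        rw [mul_add, ha, hb, add_zero]
    simpa using this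
  ext g
  have : z.coeff g⁻¹ = f g := by
    classical
    simp [z, Finsupp.single_apply]
  rw [← this, hz]; rfl

lemma irr_column (x : G) : ∑ χ ∈ (irr_finite (K := K) (G := G)).toFinset, χ x * χ x⁻¹ =
    Nat.card (Subgroup.centralizer ({x} : Set G)) := by
  classical
  let S := (irr_finite (K := K) (G := G)).toFinset
  let f : G → K := fun g => ∑ h : G, if h * x * h⁻¹ = g then 1 else 0
  have hfχ : ∀ χ ∈ IrrChars K G, ∑ g, f g * χ g⁻¹ = Nat.card G * χ x⁻¹ := by
    intro χ hχ
    simp only [f, Finset.sum_mul]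
    rw [Finset.sum_comm]
    simp only [ite_mul, one_mul, zero_mul, Finset.sum_ite_eq, Finset.mem_univ, if_true]
    have : ∀ h : G, χ (h * x * h⁻¹)⁻¹ = χ x⁻¹ := fun h => by
      rw [← irr_conj hχ x⁻¹ h]; congr 1; group
    simp only [this, Finset.sum_const, nsmul_eq_mul, Finset.card_univ, Nat.card_eq_fintype_card]
  have hf : ∀ g k, f (k * g * k⁻¹) = f g := by
    intro g k
    refine Fintype.sum_equiv (Equiv.mulLeft k⁻¹) _ _ fun h => ?_
    congr 1
    simp only [Equiv.coe_mulLeft, eq_iff_iff]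
    constructor
    · intro e
      calc _ = k⁻¹ * (h * x * h⁻¹) * k := by group
        _ = g := by rw [e]; group
    · intro e
      rw [← e]; group
  have hG : (Nat.card G : K) ≠ 0 := NeZero.ne _
  have h0 := irr_complete (fun g => Nat.card G * f g - Nat.card G * ∑ χ ∈ S, χ x⁻¹ * χ g) ?_ ?_
  · have h1 := congrFun h0 x
    simp only [Pi.zero_apply, sub_eq_zero] at h1
    have h2 := mul_left_cancel₀ hG h1
    simp_rw [mul_comm (_ : K)] at h2 ⊢
    rw [← h2]
    simp only [f, Finset.sum_boole]
    rw [Nat.card_eq_fintype_card, Fintype.card_subtype]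
    congr 2
    ext h
    simp [Subgroup.mem_centralizer_singleton_iff, mul_inv_eq_iff_eq_mul]
  · intro g k
    have : ∀ χ ∈ S, χ x⁻¹ * χ (k * g * k⁻¹) = χ x⁻¹ * χ g := fun χ hχ => by
      rw [irr_conj ((irr_finite).mem_toFinset.1 hχ)]
    simp only [hf, Finset.sum_congr rfl this]
  · intro ψ hψ
    simp only [sub_mul, Finset.sum_sub_distrib, mul_assoc, ← Finset.mul_sum]
    rw [hfχ ψ hψ]
    simp only [Finset.sum_mul]
    rw [Finset.sum_comm, Finset.sum_eq_single ψ]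
    · simp only [mul_assoc, ← Finset.mul_sum, irr_norm hψ]
      ring
    · intro χ hχ hne
      simp only [mul_assoc, ← Finset.mul_sum]
      rw [irr_orth ((irr_finite).mem_toFinset.1 hχ) hψ hne, mul_zero]
    · intro h; exact absurd ((irr_finite).mem_toFinset.2 hψ) h

lemma irr_card : (irr_finite (K := K) (G := G)).toFinset.card = Nat.card (ConjClasses G) := by
  classical
  have hG : (Nat.card G : K) ≠ 0 := NeZero.ne _
  have h1 : ∑ x : G, ∑ χ ∈ (irr_finite (K := K) (G := G)).toFinset, χ x * χ x⁻¹ =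
    ∑ x : G, (Nat.card (Subgroup.centralizer ({x} : Set G)) : K) :=
    Finset.sum_congr rfl fun x _ => irr_column x
  rw [Finset.sum_comm, Finset.sum_congr rfl
    (fun χ hχ => irr_norm ((irr_finite).mem_toFinset.1 hχ))] at h1
  have h2 : ∑ x : G, Nat.card (Subgroup.centralizer ({x} : Set G)) =
      Nat.card (ConjClasses G) * Nat.card G := by
    rw [← card_comm_eq_card_conjClasses_mul_card, ← Nat.card_sigma]
    apply Nat.card_congr
    refine (Equiv.sigmaEquivProd G G |>.subtypeEquiv (p := fun p => Commute p.1 p.2)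
      (fun _ => Iff.rfl) |>.symm.trans ?_).symm
    exact
      { toFun := fun p => ⟨p.1.1, ⟨p.1.2, Subgroup.mem_centralizer_singleton_iff.2 p.2.symm⟩⟩
        invFun := fun p => ⟨⟨p.1, p.2.1⟩, (Subgroup.mem_centralizer_singleton_iff.1 p.2.2).symm⟩
        left_inv := fun _ => rfl
        right_inv := fun _ => rfl }
  rw [← Nat.cast_sum Finset.univ, h2, Finset.sum_const, nsmul_eq_mul, Nat.cast_mul] at h1
  exact_mod_cast mul_right_cancel₀ hG h1

end

lemma irr_conj_inv {G : Type} [Group G] [Fintype G] {χ : G → ℂ} (h : χ ∈ IrrChars ℂ G) (g : G) :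
    χ g⁻¹ = starRingEnd ℂ (χ g) := by
  have h1 := irr_inv h
  have h2 := irr_map (starRingEnd ℂ) h
  by_contra hne
  have h3 := irr_orth h2 h1 (fun e => hne (congrFun e g).symm)
  simp only [inv_inv] at h3
  have h4 : ∀ g, χ g = 0 := by
    have : ∑ g, Complex.normSq (χ g) = 0 := by
      apply Complex.ofReal_injective
      push_cast
      simpa [Complex.normSq_eq_conj_mul_self] using h3
    intro g
    rw [Finset.sum_eq_zero_iff_of_nonneg (fun _ _ => Complex.normSq_nonneg _)] at this
    exact Complex.normSq_eq_zero.1 (this g (Finset.mem_univ _))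
  have := irr_norm h
  simp only [h4, mul_zero, Finset.sum_const_zero] at this
  exact NeZero.ne (Nat.card G : ℂ) this.symm


theorem card_conjClasses_le_card_centralizer_of_nonvanishing
    (G : Type) [Group G] [Fintype G] (x : G) (hx : IsNonvanishing x) :
    Nat.card (ConjClasses G) ≤ Nat.card (Subgroup.centralizer ({x} : Set G)) := by
  classical
  let K := AlgebraicClosure ℚ
  have hal : Algebra.IsAlgebraic ℚ K := by
    have := AlgebraicClosure.isAlgebraic ℚ
    have e : AlgebraicClosure.instAlgebra ℚ =
        (DivisionRing.toRatAlgebra : Algebra ℚ (AlgebraicClosure ℚ)) := Subsingleton.elim _ _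
    rw [e] at this
    exact this
  have hno : IsAlgClosure ℚ K := ⟨inferInstance, hal⟩
  have hnorm : Normal ℚ K := IsAlgClosure.normal ℚ K
  have hgal : IsGalois ℚ K := ⟨⟩
  let ι : K →+* ℂ := (IsAlgClosed.lift : K →ₐ[ℚ] ℂ).toRingHom
  let S := (irr_finite (K := K) (G := G)).toFinset
  have hS : ∀ χ, χ ∈ S ↔ χ ∈ IrrChars K G := fun χ => (irr_finite).mem_toFinset
  let P : K := ∏ χ ∈ S, χ x
  have hne : ∀ χ ∈ S, ι (χ x) ≠ 0 := by
    intro χ hχ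
    obtain ⟨V, hV, h⟩ := irr_map ι ((hS χ).1 hχ)
    have h1 := hx V hV
    rwa [h] at h1
  have hPne : P ≠ 0 := Finset.prod_ne_zero_iff.2 fun χ hχ h => hne χ hχ (by rw [h, map_zero])
  have hPint : IsIntegral ℤ P := IsIntegral.prod _ fun χ hχ => irr_integral ((hS χ).1 hχ) x
  have hPfix : ∀ σ : Gal(K/ℚ), σ P = P := by
    intro σ
    rw [map_prod]
    refine Finset.prod_nbij' (fun χ g => σ (χ g)) (fun χ g => σ.symm (χ g)) ?_ ?_ ?_ ?_ ?_
    · intro χ hχ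
      exact (hS _).2 (irr_map (σ : K →+* K) ((hS χ).1 hχ))
    · intro χ hχ
      exact (hS _).2 (irr_map (σ.symm : K →+* K) ((hS χ).1 hχ))
    · intro χ _; ext g; simp
    · intro χ _; ext g; simp
    · intro χ _; rfl
  obtain ⟨q, hq⟩ := (InfiniteGalois.mem_range_algebraMap_iff_fixed P).2 hPfix
  have hqint : IsIntegral ℤ q := by
    rw [← hq] at hPint
    exact (isIntegral_algebraMap_iff (algebraMap ℚ K).injective).1 hPint
  obtain ⟨n, hn⟩ := IsIntegrallyClosed.isIntegral_iff.1 hqint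
  have hPn : P = (n : K) := by rw [← hq, ← hn]; simp
  have hn0 : n ≠ 0 := by rintro rfl; exact hPne (by rw [hPn]; simp)
  have hprod : 1 ≤ ∏ χ ∈ S, Complex.normSq (ι (χ x)) := by
    rw [← map_prod, ← map_prod]
    change 1 ≤ Complex.normSq (ι P)
    rw [hPn, map_intCast, Complex.normSq_intCast]
    have : (1 : ℤ) ≤ n * n := by
      have := mul_self_pos.2 hn0
      lia
    exact_mod_cast this
  have hsum : ∑ χ ∈ S, Complex.normSq (ι (χ x)) =
      Nat.card (Subgroup.centralizer ({x} : Set G)) := by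
    apply Complex.ofReal_injective
    have := congrArg ι (irr_column (K := K) x)
    rw [map_sum, map_natCast] at this
    push_cast
    rw [← this]
    refine Finset.sum_congr rfl fun χ hχ => ?_
    rw [map_mul, irr_conj_inv (irr_map ι ((hS χ).1 hχ)) x, Complex.mul_conj]
  have hpos : ∀ χ ∈ S, 0 < Complex.normSq (ι (χ x)) :=
    fun χ hχ => Complex.normSq_pos.2 (hne χ hχ)
  have hlog : 0 ≤ ∑ χ ∈ S, (Complex.normSq (ι (χ x)) - 1) := by
    calc 0 ≤ Real.log (∏ χ ∈ S, Complex.normSq (ι (χ x))) := Real.log_nonneg hprod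
      _ = ∑ χ ∈ S, Real.log (Complex.normSq (ι (χ x))) :=
        Real.log_prod fun χ hχ => (hpos χ hχ).ne'
      _ ≤ _ := Finset.sum_le_sum fun χ hχ => Real.log_le_sub_one_of_pos (hpos χ hχ)
  rw [Finset.sum_sub_distrib, hsum, Finset.sum_const, nsmul_eq_mul, mul_one, sub_nonneg] at hlog
  rw [← irr_card (K := K)]
  exact_mod_cast hlog
end

section
/- Let G be a finite group and let x ∈ G be an element whose conjugacy class size satisfies |x^G| > |G|/k(G) (i.e. |x^G| exceeds the average conjugacy class size of G). Then x is a vanishing element of G, that is, χ(x) = 0 for some irreducible complex character χ of G. -/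
open CategoryTheory

section Aux

open Representation

variable {G : Type} [Group G] [Fintype G]

lemma aux_scalar {V : Type} [AddCommGroup V] [Module ℂ V] [FiniteDimensional ℂ V]
    (ρ : Representation ℂ G V) [IsIrreducible ρ] (b : G → ℂ)
    (hb : ∀ g h, b (h * g * h⁻¹) = b g) :
    ∃ c : ℂ, ∑ g, b g • ρ g = c • (1 : V →ₗ[ℂ] V) := by
  let f : IntertwiningMap ρ ρ := ⟨∑ g, b g • ρ g, by
    intro h
    rw [← Module.End.mul_eq_comp, ← Module.End.mul_eq_comp, Finset.sum_mul, Finset.mul_sum]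
    refine Fintype.sum_equiv (MulAut.conj h⁻¹).toEquiv _ _ ?_
    intro g
    have : b ((MulAut.conj h⁻¹).toEquiv g) = b g := by
      simpa using hb g h⁻¹
    rw [this, smul_mul_assoc, mul_smul_comm, ← map_mul, ← map_mul]
    congr 2
    simp [mul_assoc]⟩
  obtain ⟨c, hc⟩ :=
    (IsIrreducible.algebraMap_intertwiningMap_bijective_of_isAlgClosed (ρ := ρ)).2 f
  refine ⟨c, ?_⟩
  have := congrArg IntertwiningMap.toLinearMap hc
  have h1 : (IntertwiningMap.toLinearMap (1 : IntertwiningMap ρ ρ)) = 1 := rfl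
  simpa [f, h1] using this.symm

omit [Fintype G] in
lemma aux_finrank_pos {V : Type} [AddCommGroup V] [Module ℂ V] [FiniteDimensional ℂ V]
    (ρ : Representation ℂ G V) [h : IsIrreducible ρ] : 0 < Module.finrank ℂ V := by
  have h1 : Nontrivial ρ.asModule := IsSimpleModule.nontrivial (MonoidAlgebra ℂ G) _
  have : Nontrivial V := h1
  exact Module.finrank_pos

/-- the scalar is computed by the trace -/
lemma aux_scalar' {V : Type} [AddCommGroup V] [Module ℂ V] [FiniteDimensional ℂ V]
    (ρ : Representation ℂ G V) [IsIrreducible ρ] (b : G → ℂ)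
    (hb : ∀ g h, b (h * g * h⁻¹) = b g) :
    ∑ g, b g • ρ g = ((∑ g, b g * ρ.character g) / Module.finrank ℂ V) • (1 : V →ₗ[ℂ] V) := by
  obtain ⟨c, hc⟩ := aux_scalar ρ b hb
  have h2 := congrArg (LinearMap.trace ℂ V) hc
  have h3 : (Module.finrank ℂ V : ℂ) ≠ 0 := by
    exact_mod_cast (aux_finrank_pos ρ).ne'
  simp only [map_sum, map_smul, smul_eq_mul, LinearMap.trace_one] at h2
  rw [hc]
  congr 1
  simp only [character]
  rw [h2]
  field_simp

lemma aux_eigen {V : Type} [AddCommGroup V] [Module ℂ V] [FiniteDimensional ℂ V]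
    (ρ : Representation ℂ G V) (x : G) :
    star (ρ.character x) = ρ.character x⁻¹ ∧ IsIntegral ℤ (ρ.character x) := by
  set f : Module.End ℂ V := ρ x with hf
  set n := orderOf x with hn
  have hn0 : 0 < n := orderOf_pos x
  have hfn : f ^ n = 1 := by rw [hf, ← map_pow, pow_orderOf_eq_one, map_one]
  have hss : f.IsSemisimple := by
    refine Module.End.isSemisimple_of_squarefree_aeval_eq_zero
      (p := Polynomial.X ^ n - 1) ?_ ?_
    · have := (Polynomial.X_pow_sub_one_separable_iff (F := ℂ) (n := n)).2
        (by exact_mod_cast hn0.ne')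
      exact this.squarefree
    · simp [hfn]
  have htop := hss.iSup_eigenspace_eq_top
  have hint : DirectSum.IsInternal f.eigenspace :=
    (DirectSum.isInternal_submodule_iff_iSupIndep_and_iSup_eq_top _).2
      ⟨f.eigenspaces_iSupIndep, htop⟩
  have hfin : {μ | f.eigenspace μ ≠ ⊥}.Finite :=
    WellFoundedGT.finite_ne_bot_of_iSupIndep f.eigenspaces_iSupIndep
  have hμ : ∀ μ ∈ hfin.toFinset, μ ^ n = 1 := by
    intro μ h
    rw [Set.Finite.mem_toFinset] at h
    obtain ⟨v, hv, hv0⟩ := Submodule.exists_mem_ne_zero_of_ne_bot h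
    have : (f ^ n) v = μ ^ n • v := by
      clear hfn
      induction n with
      | zero => simp
      | succ k ih => 
        rw [pow_succ', Module.End.mul_apply, ih, map_smul, Module.End.mem_eigenspace_iff.1 hv,
          smul_smul, pow_succ]
    rw [hfn] at this
    have h2 : (μ ^ n - 1) • v = 0 := by rw [sub_smul, ← this]; simp
    rcases smul_eq_zero.1 h2 with h | h
    · linear_combination h
    · exact absurd h hv0
  have key : ∀ (f' : V →ₗ[ℂ] V) (c : ℂ → ℂ),
      (∀ μ ∈ hfin.toFinset, ∀ v ∈ f.eigenspace μ, f' v = c μ • v) →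
      LinearMap.trace ℂ V f' = ∑ μ ∈ hfin.toFinset, c μ * Module.finrank ℂ (f.eigenspace μ) := by
    intro f' c h
    have hm : ∀ μ, Set.MapsTo f' (f.eigenspace μ) (f.eigenspace μ) := by
      intro μ v hv
      by_cases hb : f.eigenspace μ = ⊥
      · rw [hb] at hv ⊢
        have : v = 0 := by simpa using hv
        simp [this]
      · rw [h μ (by simpa using hb) v hv]
        exact Submodule.smul_mem _ _ hv
    rw [LinearMap.trace_eq_sum_trace_restrict' hint hfin hm]
    refine Finset.sum_congr rfl fun μ hμ => ?_
    have : f'.restrict (hm μ) = c μ • (1 : Module.End ℂ (f.eigenspace μ)) := by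
      ext v
      exact h μ hμ v v.2
    rw [this, map_smul, LinearMap.trace_one, smul_eq_mul]
  have k1 : ρ.character x = _ := key (ρ x) id (fun μ _ v hv => Module.End.mem_eigenspace_iff.1 hv)
  have k2 : ρ.character x⁻¹ = _ := key (ρ x⁻¹) (fun μ => μ⁻¹) (by
    intro μ h v hv
    have hv' : ρ x v = μ • v := Module.End.mem_eigenspace_iff.1 hv
    have h0 : μ ≠ 0 := by
      rintro rfl
      have := hμ 0 h
      rw [zero_pow hn0.ne'] at this
      exact zero_ne_one this
    have : ρ x⁻¹ (ρ x v) = v := by simp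
    rw [hv', map_smul] at this
    rw [← this, smul_smul, inv_mul_cancel₀ h0, one_smul, this])
  constructor
  · rw [k1, k2, star_sum]
    refine Finset.sum_congr rfl fun μ h => ?_
    have hnorm : ‖μ‖ = 1 := Complex.norm_eq_one_of_pow_eq_one (hμ μ h) hn0.ne'
    rw [Complex.inv_eq_conj hnorm]
    simp
  · rw [k1]
    refine IsIntegral.sum _ fun μ h => IsIntegral.mul ?_ ?_
    · exact IsIntegral.of_pow hn0 (by rw [id, hμ μ h]; exact isIntegral_one)
    · exact isIntegral_natCast _

lemma aux_simple {V : Type} [AddCommGroup V] [Module ℂ V] [FiniteDimensional ℂ V]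
    (ρ : Representation ℂ G V) [IsIrreducible ρ] : Simple (FDRep.of ρ) := by
  have inv : Invertible (Nat.card G : ℂ) := invertibleOfNonzero (NeZero.ne (Nat.card G : ℂ))
  rw [FDRep.simple_iff_char_is_norm_one]
  have := char_orthonormal ρ ρ
  rw [if_pos ⟨Representation.Equiv.refl _⟩, inv_mul_eq_one₀ (NeZero.ne (Nat.card G : ℂ))] at this
  exact this.symm

omit [Fintype G] in
lemma aux_ofModule_hom (M : Type) [AddCommGroup M] [Module ℂ M] [Module (MonoidAlgebra ℂ G) M]
    [IsScalarTower ℂ (MonoidAlgebra ℂ G) M] (r : MonoidAlgebra ℂ G) (m : M) :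
    (ofModule' (k := ℂ) (G := G) M).asAlgebraHom r m = r • m := by
  have : (ofModule' (k := ℂ) (G := G) M).asAlgebraHom = Algebra.lsmul ℂ ℂ M := by
    exact Equiv.apply_symm_apply (MonoidAlgebra.lift ℂ (M →ₗ[ℂ] M) G) (Algebra.lsmul ℂ ℂ M)
  rw [this]
  rfl

omit [Fintype G] in
lemma aux_ofModule_irr (M : Type) [AddCommGroup M] [Module ℂ M] [Module (MonoidAlgebra ℂ G) M]
    [IsScalarTower ℂ (MonoidAlgebra ℂ G) M] [IsSimpleModule (MonoidAlgebra ℂ G) M] :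
    IsIrreducible (ofModule' (k := ℂ) (G := G) M) := by
  rw [irreducible_iff_isSimpleModule_asModule]
  let e : (ofModule' (k := ℂ) (G := G) M).asModule ≃ₗ[MonoidAlgebra ℂ G] M :=
    { (ofModule' (k := ℂ) (G := G) M).asModuleEquiv.toAddEquiv with
      map_smul' := by
        intro r m
        exact (asModuleEquiv_map_smul _ r m).trans (aux_ofModule_hom M r _) }
  exact IsSimpleModule.congr e

lemma aux_regular (b : G → ℂ) (hb : ∀ g h, b (h * g * h⁻¹) = b g)
    (h : ∀ (V : Type) [AddCommGroup V] [Module ℂ V] [FiniteDimensional ℂ V]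
      (ρ : Representation ℂ G V) [IsIrreducible ρ], ∑ g, b g * ρ.character g = 0) :
    b = 0 := by
  classical
  set z : MonoidAlgebra ℂ G := ∑ g, MonoidAlgebra.single g (b g) with hz
  have hss : IsSemisimpleModule (MonoidAlgebra ℂ G) (MonoidAlgebra ℂ G) := inferInstance
  have hz0 : ∀ S : Submodule (MonoidAlgebra ℂ G) (MonoidAlgebra ℂ G),
      IsSimpleModule (MonoidAlgebra ℂ G) S → ∀ s : S, z • s = 0 := by
    intro S hS s
    have hirr := aux_ofModule_irr (G := G) S
    have : Module.Finite (MonoidAlgebra ℂ G) S := inferInstance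
    have hG : Module.Finite ℂ (MonoidAlgebra ℂ G) := inferInstance
    have : FiniteDimensional ℂ S := Module.Finite.trans (MonoidAlgebra ℂ G) _
    have h1 := aux_scalar' (ofModule' (k := ℂ) (G := G) S) b hb
    rw [h, zero_div, zero_smul] at h1
    have h2 : (ofModule' (k := ℂ) (G := G) S).asAlgebraHom z = 0 := by
      rw [hz, map_sum, ← h1]
      simp [asAlgebraHom_single]
    have h3 := aux_ofModule_hom (G := G) S z s
    rw [h2] at h3
    exact h3.symm
  have htop := IsSemisimpleModule.sSup_simples_eq_top (MonoidAlgebra ℂ G) (MonoidAlgebra ℂ G)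
  have hann : ∀ w : MonoidAlgebra ℂ G, z * w = 0 := by
    intro w
    have hw : w ∈ sSup {m : Submodule (MonoidAlgebra ℂ G) (MonoidAlgebra ℂ G) |
      IsSimpleModule (MonoidAlgebra ℂ G) m} := by rw [htop]; trivial
    rw [sSup_eq_iSup'] at hw
    induction hw using Submodule.iSup_induction' with
    | mem S w hw => exact congrArg Subtype.val (hz0 S.1 S.2 ⟨w, hw⟩)
    | zero => simp
    | add a b _ _ ha hb => rw [mul_add, ha, hb, add_zero]
  have hz1 := hann 1
  rw [mul_one, hz] at hz1
  funext g
  have := congrArg (fun w : MonoidAlgebra ℂ G => w.coeff g) hz1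
  simpa [Finsupp.finsetSum_apply, Finsupp.single_apply] using this

/-- Irreducible characters, as functions on conjugacy classes. -/
def AuxIrrChar (χ : ConjClasses G → ℂ) : Prop :=
  ∃ (V : Type) (_ : AddCommGroup V) (_ : Module ℂ V) (_ : FiniteDimensional ℂ V)
    (ρ : Representation ℂ G V), IsIrreducible ρ ∧ ∀ g, χ (ConjClasses.mk g) = ρ.character g

omit [Fintype G] in
lemma aux_exists_class {V : Type} [AddCommGroup V] [Module ℂ V] [FiniteDimensional ℂ V]
    (ρ : Representation ℂ G V) :
    ∃ χ : ConjClasses G → ℂ, ∀ g, χ (ConjClasses.mk g) = ρ.character g := by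
  refine ⟨Quotient.lift ρ.character ?_, fun g => rfl⟩
  intro a b hab
  obtain ⟨c, hc⟩ := isConj_iff.1 (show IsConj a b from hab)
  rw [← hc, char_conj]

lemma aux_orth_self {χ : ConjClasses G → ℂ} (h : AuxIrrChar χ) :
    ∑ g : G, χ (ConjClasses.mk g) * χ (ConjClasses.mk g⁻¹) = Nat.card G := by
  obtain ⟨V, _, _, _, ρ, hρ, hχ⟩ := h
  have inv : Invertible (Nat.card G : ℂ) := invertibleOfNonzero (NeZero.ne (Nat.card G : ℂ))
  have := char_orthonormal ρ ρ
  rw [if_pos ⟨Representation.Equiv.refl _⟩, inv_mul_eq_one₀ (NeZero.ne (Nat.card G : ℂ))] at this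
  simp only [hχ]
  exact this.symm

lemma aux_orth_ne {χ ψ : ConjClasses G → ℂ} (h : AuxIrrChar χ) (h' : AuxIrrChar ψ)
    (hne : χ ≠ ψ) :
    ∑ g : G, χ (ConjClasses.mk g) * ψ (ConjClasses.mk g⁻¹) = 0 := by
  obtain ⟨V, _, _, _, ρ, hρ, hχ⟩ := h
  obtain ⟨W, _, _, _, σ, hσ, hψ⟩ := h'
  have inv : Invertible (Nat.card G : ℂ) := invertibleOfNonzero (NeZero.ne (Nat.card G : ℂ))
  have := char_orthonormal ρ σ
  rw [if_neg] at this
  · simp only [hχ, hψ]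
    exact (mul_eq_zero.1 this).resolve_left (inv_ne_zero (NeZero.ne (Nat.card G : ℂ)))
  · rintro ⟨e⟩
    apply hne
    funext c
    obtain ⟨g, rfl⟩ := ConjClasses.mk_surjective c
    rw [hχ, hψ, char_iso e]

lemma aux_coeff {ι : Type} [Fintype ι] (v : ι → ConjClasses G → ℂ)
    (hv : Function.Injective v) (h : ∀ i, AuxIrrChar (v i)) (c : ι → ℂ) (i : ι) :
    ∑ g : G, (∑ j, c j • v j) (ConjClasses.mk g) * v i (ConjClasses.mk g⁻¹) =
      c i * Nat.card G := by
  classical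
  simp only [Finset.sum_apply, Pi.smul_apply, smul_eq_mul, Finset.sum_mul]
  rw [Finset.sum_comm, Finset.sum_eq_single i]
  · rw [← aux_orth_self (h i), Finset.mul_sum]
    simp only [mul_assoc]
  · intro j _ hj
    simp only [mul_assoc]
    rw [← Finset.mul_sum, aux_orth_ne (h j) (h i) (fun e => hj (hv e)), mul_zero]
  · simp

lemma aux_li : LinearIndependent ℂ
    (fun s : {χ : ConjClasses G → ℂ // AuxIrrChar χ} => s.1) := by
  classical
  rw [linearIndependent_iff_finset_linearIndependent]
  intro t
  rw [Fintype.linearIndependent_iff]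
  intro c hc i
  have := aux_coeff (fun s : t => s.1.1) (fun a b hab => Subtype.ext (Subtype.ext hab))
    (fun s => s.1.2) c i
  have h0 : ∑ j : t, c j • j.1.1 = 0 := hc
  rw [h0] at this
  simpa using this.symm

lemma aux_span : (⊤ : Submodule ℂ (ConjClasses G → ℂ)) ≤ Submodule.span ℂ
    (Set.range (fun s : {χ : ConjClasses G → ℂ // AuxIrrChar χ} => s.1)) := by
  classical
  have : Fintype (ConjClasses G) := Fintype.ofFinite _
  by_contra hcon
  obtain ⟨φ, hφ, hle⟩ := Submodule.exists_le_ker_of_lt_top _ (lt_top_iff_ne_top.2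
    (fun h => hcon h.ge))
  apply hφ
  let N : ConjClasses G → ℕ := fun c => (Finset.univ.filter fun g : G => ConjClasses.mk g = c).card
  have hN : ∀ c, (N c : ℂ) ≠ 0 := by
    intro c
    obtain ⟨g, rfl⟩ := ConjClasses.mk_surjective c
    have : 0 < N (ConjClasses.mk g) := Finset.card_pos.2 ⟨g, by simp⟩
    exact_mod_cast this.ne'
  let b' : ConjClasses G → ℂ := fun c => φ (Pi.single c 1) / N c
  have hb : (fun g => b' (ConjClasses.mk g)) = (0 : G → ℂ) := by
    apply aux_regular
    · intro g h
      congr 1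
      exact ConjClasses.mk_eq_mk_iff_isConj.2 (isConj_iff.2 ⟨h⁻¹, by group⟩)
    · intro V _ _ _ ρ hρ
      obtain ⟨χ, hχ⟩ := aux_exists_class ρ
      have hk : φ χ = 0 := hle (Submodule.subset_span ⟨⟨χ, V, _, _, ‹_›, ρ, hρ, hχ⟩, rfl⟩)
      simp only [← hχ]
      rw [← Finset.sum_fiberwise (s := Finset.univ) (g := fun g : G => ConjClasses.mk g)]
      have h1 : ∀ c, ∑ g ∈ Finset.univ.filter (fun g : G => ConjClasses.mk g = c),
          b' (ConjClasses.mk g) * χ (ConjClasses.mk g) = φ (Pi.single c 1) * χ c := by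
        intro c
        rw [Finset.sum_congr rfl (g := fun _ => b' c * χ c)
          (fun g hg => by rw [(Finset.mem_filter.1 hg).2])]
        rw [Finset.sum_const, nsmul_eq_mul]
        have := hN c
        simp only [b']
        change (N c : ℂ) * _ = _
        field_simp
      rw [Finset.sum_congr rfl (fun c _ => h1 c)]
      rw [LinearMap.pi_apply_eq_sum_univ φ χ] at hk
      rw [← hk]
      refine Finset.sum_congr rfl fun c _ => ?_
      rw [smul_eq_mul, mul_comm]
      congr 2
      ext d
      simp [Pi.single_apply, eq_comm]
  refine LinearMap.pi_ext' fun c => LinearMap.ext_ring ?_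
  obtain ⟨g, rfl⟩ := ConjClasses.mk_surjective c
  have := congrFun hb g
  simp only [b', Pi.zero_apply, div_eq_zero_iff, hN, or_false] at this
  simpa using this

lemma aux_eigenvec {χ : ConjClasses G → ℂ} (h : AuxIrrChar χ) (x : G) (K : Finset G)
    (hK : ∀ y, y ∈ K ↔ ConjClasses.mk y = ConjClasses.mk x) :
    ∃ d : ℕ, 0 < d ∧ ∀ g, ∑ y ∈ K, χ (ConjClasses.mk (g * y)) =
      (K.card * χ (ConjClasses.mk x) / d) * χ (ConjClasses.mk g) := by
  classical
  obtain ⟨V, _, _, _, ρ, hρ, hχ⟩ := h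
  refine ⟨Module.finrank ℂ V, aux_finrank_pos ρ, fun g => ?_⟩
  have h1 := aux_scalar' ρ (fun y => if y ∈ K then 1 else 0) (by
    intro g h
    have : ConjClasses.mk (h * g * h⁻¹) = ConjClasses.mk g :=
      ConjClasses.mk_eq_mk_iff_isConj.2 (isConj_iff.2 ⟨h⁻¹, by group⟩)
    simp only [hK, this])
  simp only [ite_smul, one_smul, zero_smul, ite_mul, one_mul, zero_mul, Finset.sum_ite_mem,
    Finset.univ_inter] at h1
  have h2 : ∑ y ∈ K, ρ.character y = K.card * χ (ConjClasses.mk x) := by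
    rw [Finset.sum_congr rfl (g := fun _ => χ (ConjClasses.mk x))
      (fun y hy => by rw [← hχ, (hK y).1 hy]), Finset.sum_const, nsmul_eq_mul]
  rw [h2] at h1
  have h3 := congrArg (fun f => LinearMap.trace ℂ V (ρ g * f)) h1
  simp only [Finset.mul_sum, map_sum, mul_smul_comm, mul_one, map_smul, smul_eq_mul,
    ← map_mul] at h3
  simp only [hχ]
  simp only [hχ] at h3
  exact h3

end Aux

lemma aux_main (G : Type) [Group G] [Fintype G] (x : G)
    (hnz : ∀ χ : ConjClasses G → ℂ, AuxIrrChar χ → χ (ConjClasses.mk x) ≠ 0) :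
    Nat.card (ConjClasses G) * Nat.card {h : G // IsConj x h} ≤ Nat.card G := by
  classical
  have : Fintype (ConjClasses G) := Fintype.ofFinite _
  let S := {χ : ConjClasses G → ℂ // AuxIrrChar χ}
  let bS : Module.Basis S ℂ (ConjClasses G → ℂ) := Module.Basis.mk aux_li aux_span
  have hbS : ∀ s : S, bS s = s.1 := fun s => by simp [bS]
  have : Fintype S := FiniteDimensional.fintypeBasisIndex bS
  have hcard : Fintype.card S = Nat.card (ConjClasses G) := by
    rw [← Module.finrank_eq_card_basis bS]
    simp
  let K : Finset G := Finset.univ.filter fun y => ConjClasses.mk y = ConjClasses.mk x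
  have hK : ∀ y, y ∈ K ↔ ConjClasses.mk y = ConjClasses.mk x := by simp [K]
  have hKcard : Nat.card {h : G // IsConj x h} = K.card := by
    rw [Nat.card_eq_fintype_card, Fintype.card_subtype]
    congr 1
    ext y
    simp only [K, ConjClasses.mk_eq_mk_iff_isConj, Finset.mem_filter, Finset.mem_univ, true_and]
    exact isConj_comm
  have hKpos : 0 < K.card := Finset.card_pos.2 ⟨x, by simp [K]⟩
  -- characters: integrality and conjugation
  have hint : ∀ s : S, ∀ g, star (s.1 (ConjClasses.mk g)) = s.1 (ConjClasses.mk g⁻¹) ∧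
      IsIntegral ℤ (s.1 (ConjClasses.mk g)) := by
    rintro ⟨χ, V, _, _, _, ρ, hρ, hχ⟩ g
    simp only [hχ]
    exact aux_eigen ρ g
  -- column orthogonality
  have hcol : ∑ s : S, ‖s.1 (ConjClasses.mk x)‖ ^ 2 * K.card = (Nat.card G : ℝ) := by
    set δ : ConjClasses G → ℂ := Pi.single (ConjClasses.mk x) 1 with hδ
    have hc : ∀ s : S, bS.repr δ s * Nat.card G = K.card * star (s.1 (ConjClasses.mk x)) := by
      intro s
      rw [← aux_coeff (fun s : S => s.1) Subtype.val_injective (fun s => s.2)]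
      have : ∑ j : S, bS.repr δ j • j.1 = δ := by
        simp only [← hbS]
        exact bS.sum_repr δ
      rw [this]
      rw [← nsmul_eq_mul, ← Finset.sum_const, ← Finset.sum_subset (Finset.subset_univ K)]
      · refine Finset.sum_congr rfl fun y hy => ?_
        rw [← (hint s y).1, (hK y).1 hy, hδ]
        simp
      · intro y _ hy
        rw [hK] at hy
        rw [hδ, Pi.single_eq_of_ne hy, zero_mul]
    have h1 : ∑ j : S, bS.repr δ j * j.1 (ConjClasses.mk x) = 1 := by
      have := congrFun (bS.sum_repr δ) (ConjClasses.mk x)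
      rw [hδ] at this ⊢
      simpa [hbS] using this
    have h2 : (∑ s : S, (‖s.1 (ConjClasses.mk x)‖ ^ 2 * K.card : ℂ)) = (Nat.card G : ℂ) := by
      rw [← one_mul (Nat.card G : ℂ), ← h1, Finset.sum_mul]
      refine Finset.sum_congr rfl fun s _ => ?_
      rw [mul_right_comm, hc s, ← Complex.conj_mul', mul_comm, mul_assoc]
      rfl
    exact_mod_cast h2
  -- the product is an integer
  choose d hd hev using fun s : S => aux_eigenvec s.2 x K hK
  obtain ⟨r, hr⟩ : ∃ r : ConjClasses G → G, ∀ c, ConjClasses.mk (r c) = c :=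
    ⟨_, Function.surjInv_eq ConjClasses.mk_surjective⟩
  let M : Matrix (ConjClasses G) (ConjClasses G) ℤ := Matrix.of fun c e =>
    ∑ y ∈ K, if ConjClasses.mk (r c * y) = e then 1 else 0
  let T := Matrix.toLin' (M.map (Int.cast : ℤ → ℂ))
  have hT : ∀ (f : ConjClasses G → ℂ) c,
      T f c = ∑ y ∈ K, f (ConjClasses.mk (r c * y)) := by
    intro f c
    simp only [T, M, Matrix.toLin'_apply, Matrix.mulVec, dotProduct, Matrix.map_apply, Matrix.of_apply,
      Int.cast_sum, Int.cast_ite, Int.cast_one, Int.cast_zero, Finset.sum_mul]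
    rw [Finset.sum_comm]
    simp
  have hTs : ∀ s : S, T s.1 = (K.card * s.1 (ConjClasses.mk x) / d s) • s.1 := by
    intro s
    funext c
    rw [hT, hev s]
    rw [hr]
    rfl
  have hdet : (M.det : ℂ) = ∏ s : S, (K.card * s.1 (ConjClasses.mk x) / d s) := by
    have h1 : LinearMap.det T = M.det := by
      rw [LinearMap.det_toLin']
      exact (Int.cast_det M).symm
    have h2 : LinearMap.toMatrix bS bS T =
        Matrix.diagonal fun s : S => (K.card * s.1 (ConjClasses.mk x) / d s : ℂ) := by
      ext i j
      rw [LinearMap.toMatrix_apply, hbS, hTs, ← hbS j, map_smul, bS.repr_self]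
      by_cases hij : i = j
      · subst hij; simp [hbS]
      · simp [Matrix.diagonal_apply_ne _ hij, Ne.symm hij]
    rw [← h1, ← LinearMap.det_toMatrix bS, h2, Matrix.det_diagonal]
  set P : ℂ := ∏ s : S, s.1 (ConjClasses.mk x) with hP
  have hPint : IsIntegral ℤ P := IsIntegral.prod _ fun s _ => (hint s x).2
  have hPrat : ∃ q : ℚ, (q : ℂ) = P := by
    generalize M.det = D at hdet
    refine ⟨D * (∏ s : S, (d s : ℚ)) / (K.card : ℚ) ^ Fintype.card S, ?_⟩
    push_cast
    rw [hdet, Finset.prod_div_distrib, Finset.prod_mul_distrib, Finset.prod_const,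
      Finset.card_univ]
    have h1 : (K.card : ℂ) ≠ 0 := by exact_mod_cast hKpos.ne'
    have h2 : (∏ s : S, (d s : ℂ)) ≠ 0 :=
      Finset.prod_ne_zero_iff.2 fun s _ => by exact_mod_cast (hd s).ne'
    field_simp
    rfl
  obtain ⟨q, hq⟩ := hPrat
  obtain ⟨m, hm⟩ : ∃ m : ℤ, (m : ℂ) = P := by
    rw [← hq] at hPint
    have h1 : IsIntegral ℤ q :=
      (isIntegral_algebraMap_iff (R := ℤ) (A := ℚ) (B := ℂ) (algebraMap ℚ ℂ).injective).1
        (by simpa using hPint)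
    obtain ⟨m, hm⟩ := IsIntegrallyClosed.isIntegral_iff.1 h1
    refine ⟨m, ?_⟩
    rw [← hq, ← hm]
    simp
  have hP0 : P ≠ 0 := Finset.prod_ne_zero_iff.2 fun s _ => hnz s.1 s.2
  have hP1 : 1 ≤ ‖P‖ := by
    rw [← hm] at hP0 ⊢
    have : m ≠ 0 := by exact_mod_cast hP0
    rw [Complex.norm_intCast]
    exact_mod_cast Int.one_le_abs this
  have hamgm : (Fintype.card S : ℝ) ≤ ∑ s : S, ‖s.1 (ConjClasses.mk x)‖ ^ 2 := by
    have h0 : ∀ s : S, 0 < ‖s.1 (ConjClasses.mk x)‖ ^ 2 := fun s =>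
      pow_pos (norm_pos_iff.2 (hnz s.1 s.2)) 2
    have h1 : ∑ s : S, Real.log (‖s.1 (ConjClasses.mk x)‖ ^ 2) ≤
        ∑ s : S, (‖s.1 (ConjClasses.mk x)‖ ^ 2 - 1) :=
      Finset.sum_le_sum fun s _ => Real.log_le_sub_one_of_pos (h0 s)
    rw [← Real.log_prod (fun s _ => (h0 s).ne'), Finset.prod_pow, ← norm_prod, ← hP,
      Finset.sum_sub_distrib] at h1
    have h2 : 0 ≤ Real.log (‖P‖ ^ 2) := Real.log_nonneg (one_le_pow₀ hP1)
    simp at h1 h2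
    linarith
  rw [← hcard, hKcard]
  rw [← Finset.sum_mul] at hcol
  have : (Fintype.card S : ℝ) * K.card ≤ Nat.card G := by
    rw [← hcol]
    gcongr
  exact_mod_cast this

theorem vanishing_of_large_conjClass
    (G : Type) [Group G] [Fintype G] (x : G)
    (hx : (Nat.card G : ℚ) / (Nat.card (ConjClasses G) : ℚ) <
      (Nat.card {h : G // IsConj x h} : ℚ)) :
    ∃ V : FDRep ℂ G, Simple V ∧ V.character x = 0 := by
  by_contra hcon
  have h := aux_main G x (by
    rintro χ ⟨V, _, _, _, ρ, hρ, hχ⟩ h0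
    refine hcon ⟨FDRep.of ρ, aux_simple ρ, ?_⟩
    rw [hχ] at h0
    exact h0)
  have hk : 0 < Nat.card (ConjClasses G) := Nat.card_pos
  rw [div_lt_iff₀ (by exact_mod_cast hk), mul_comm] at hx
  have hx' : Nat.card G < Nat.card (ConjClasses G) * Nat.card {h : G // IsConj x h} := by
    exact_mod_cast hx
  omega
end

section
/- Let n ≥ 6 be an integer and let x be an element of the alternating group A_n. Then there exists a partition λ of n which is not equal to its conjugate (transpose) partition such that χ^λ(x) ≠ ±1, where χ^λ denotes the irreducible complex character of the symmetric group S_n labeled by λ. -/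
open CategoryTheory
namespace PermAux

/-- number of fixed points -/
def fixN {n : ℕ} (g : Equiv.Perm (Fin n)) : ℕ := (Finset.univ.filter fun i => g i = i).card

lemma card_fixed_emb {n : ℕ} (k : ℕ) (g : Equiv.Perm (Fin n)) :
    (Finset.univ.filter fun e : Fin k ↪ Fin n => ∀ j, g (e j) = e j).card
      = (fixN g).descFactorial k := by
  classical
  have h : Fintype.card (Fin k ↪ {i : Fin n // g i = i}) = (fixN g).descFactorial k := by
    rw [Fintype.card_embedding_eq, Fintype.card_fin, fixN, Fintype.card_subtype]
  rw [← h, ← Fintype.card_subtype]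
  refine Fintype.card_congr ?_
  refine ⟨fun e => ⟨fun j => ⟨e.1 j, e.2 j⟩, ?_⟩, fun f => ⟨f.trans (Function.Embedding.subtype _), ?_⟩, ?_, ?_⟩
  · intro a b hab
    exact e.1.injective (congrArg Subtype.val hab)
  · intro j; exact (f j).2
  · intro e; ext; rfl
  · intro f; ext; rfl

lemma sum_desc {n k : ℕ} (hk : k ≤ n) :
    ∑ g : Equiv.Perm (Fin n), (fixN g).descFactorial k = Nat.card (Equiv.Perm (Fin n)) := by
  classical
  have hb := MulAction.sum_card_fixedBy_eq_card_orbits_mul_card_group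
    (Equiv.Perm (Fin n)) (Fin k ↪ Fin n)
  have : MulAction.IsPretransitive (Equiv.Perm (Fin n)) (Fin k ↪ Fin n) :=
    Equiv.Perm.isMultiplyPretransitive (Fin n) k
  have hne : Nonempty (Fin k ↪ Fin n) := ⟨Fin.castLEEmb hk⟩
  have ho : Fintype.card (Quotient (MulAction.orbitRel (Equiv.Perm (Fin n)) (Fin k ↪ Fin n))) = 1 := by
    rw [Fintype.card_eq_one_iff_nonempty_unique]
    have := (MulAction.pretransitive_iff_subsingleton_quotient (Equiv.Perm (Fin n)) (Fin k ↪ Fin n)).1 this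
    obtain ⟨e⟩ := hne
    exact ⟨⟨⟨Quotient.mk _ e⟩, fun a => Subsingleton.elim _ _⟩⟩
  rw [ho, one_mul] at hb
  rw [Nat.card_eq_fintype_card, ← hb]
  refine Finset.sum_congr rfl fun g _ => ?_
  rw [← card_fixed_emb, ← Fintype.card_subtype]
  refine Fintype.card_congr (Equiv.subtypeEquivRight fun e => ?_)
  rw [MulAction.mem_fixedBy, DFunLike.ext_iff]
  rfl

lemma sum_sign_desc {n k : ℕ} (hk : k + 2 ≤ n) :
    ∑ g : Equiv.Perm (Fin n), ((Equiv.Perm.sign g : ℤˣ) : ℤ) * ((fixN g).descFactorial k : ℤ) = 0 := by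
  classical
  simp_rw [← card_fixed_emb, Finset.card_filter, Nat.cast_sum, Finset.mul_sum]
  rw [Finset.sum_comm]
  refine Finset.sum_eq_zero fun e _ => ?_
  obtain ⟨a, b, hab, ha, hb⟩ : ∃ a b : Fin n, a ≠ b ∧ (∀ j, e j ≠ a) ∧ (∀ j, e j ≠ b) := by
    have hc : 1 < ((Finset.univ.map e)ᶜ).card := by
      rw [Finset.card_compl, Finset.card_map]; simp; omega
    obtain ⟨a, ha, b, hb, hab⟩ := Finset.one_lt_card.1 hc
    exact ⟨a, b, hab, by simpa using ha, by simpa using hb⟩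
  refine Finset.sum_involution (fun g _ => g * Equiv.swap a b) ?_ ?_ ?_ ?_
  · intro g _
    have : ∀ j, (g * Equiv.swap a b) (e j) = g (e j) := fun j => by
      rw [Equiv.Perm.mul_apply, Equiv.swap_apply_of_ne_of_ne (ha j) (hb j)]
    simp only [this, Equiv.Perm.sign_mul, Equiv.Perm.sign_swap hab]
    push_cast; ring
  · intro g _ _ h
    have : Equiv.swap a b = 1 := by simpa using h
    exact hab (Equiv.swap_eq_one_iff.1 this)
  · intros; simp
  · intro g _; simp [mul_assoc]

lemma fixN_inv {n : ℕ} (g : Equiv.Perm (Fin n)) : fixN g⁻¹ = fixN g := by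
  unfold fixN
  congr 1
  ext i
  simp only [Finset.mem_filter, Finset.mem_univ, true_and]
  rw [Equiv.Perm.inv_eq_iff_eq, eq_comm]

/-- permutation representation -/
noncomputable def permRep (n : ℕ) : Representation ℂ (Equiv.Perm (Fin n)) (Fin n → ℂ) where
  toFun g := LinearMap.funLeft ℂ ℂ (g⁻¹ : Equiv.Perm (Fin n))
  map_one' := by ext; simp [LinearMap.funLeft]
  map_mul' g h := by ext; simp [LinearMap.funLeft]

lemma permRep_char {n : ℕ} (g : Equiv.Perm (Fin n)) : (permRep n).character g = fixN g := by
  classical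
  rw [Representation.character, LinearMap.trace_eq_matrix_trace ℂ (Pi.basisFun ℂ (Fin n)), Matrix.trace, ← fixN_inv g, fixN, Finset.card_filter]
  push_cast
  refine Finset.sum_congr rfl fun i _ => ?_
  simp [permRep, LinearMap.funLeft, Pi.single_apply]

lemma triv_char (n : ℕ) (g : Equiv.Perm (Fin n)) : (Representation.trivial ℂ (Equiv.Perm (Fin n)) ℂ).character g = 1 := by
  simp [Representation.character]

variable {G : Type} [Group G] [Fintype G]

lemma simple_of {V : Type} [AddCommGroup V] [Module ℂ V] [FiniteDimensional ℂ V]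
    (ρ : Representation ℂ G V) [ρ.IsIrreducible] : Simple (FDRep.of ρ) := by
  rw [FDRep.simple_iff_char_is_norm_one]
  have hN : (Nat.card G : ℂ) ≠ 0 := by exact_mod_cast Nat.card_pos.ne'
  have := invertibleOfNonzero hN
  have h := Representation.char_orthonormal ρ ρ
  rw [if_pos ⟨Representation.Equiv.refl ρ⟩, inv_mul_eq_one₀ hN] at h
  exact h.symm

/-- the virtual characters -/
def virt (G : Type) [Group G] [Fintype G] : Submodule ℤ (G → ℂ) :=
  Submodule.span ℤ {f | ∃ W : FDRep ℂ G, Simple W ∧ W.character = f}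

lemma char_mem_virt (d : ℕ) : ∀ {V : Type} [AddCommGroup V] [Module ℂ V] [FiniteDimensional ℂ V]
    (ρ : Representation ℂ G V), Module.finrank ℂ V ≤ d → ρ.character ∈ virt G := by
  classical
  induction d with
  | zero =>
    intro V _ _ _ ρ hd
    have : Subsingleton V := Module.finrank_zero_iff (R := ℂ).1 (by omega)
    have : ρ.character = 0 := by
      ext g
      rw [Representation.character, Subsingleton.elim (ρ g) 0]; simp
    rw [this]; exact zero_mem _
  | succ d ih =>
    intro V _ _ _ ρ hd
    by_cases hirr : ρ.IsIrreducible
    · exact Submodule.subset_span ⟨FDRep.of ρ, simple_of ρ, rfl⟩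
    by_cases h0 : Module.finrank ℂ V = 0
    · exact ih ρ (by omega)
    have : Nontrivial V := Module.nontrivial_of_finrank_pos (R := ℂ) (by omega)
    have hnt : Nontrivial (Subrepresentation ρ) := by
      refine ⟨⟨⊥, ⊤, fun h => ?_⟩⟩
      have := congrArg Subrepresentation.toSubmodule h
      exact (bot_ne_top : (⊥ : Submodule ℂ V) ≠ ⊤) this
    obtain ⟨A, hA0, hA1⟩ : ∃ A : Subrepresentation ρ, A ≠ ⊥ ∧ A ≠ ⊤ := by
      by_contra hcon
      push Not at hcon
      exact hirr ⟨fun A => or_iff_not_imp_left.2 (hcon A)⟩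
    have : NeZero (Nat.card G : ℂ) := ⟨by exact_mod_cast Nat.card_pos.ne'⟩
    have hss : ρ.IsSemisimpleRepresentation := inferInstance
    obtain ⟨B, hAB⟩ := hss.exists_isCompl A
    have hc : IsCompl A.toSubmodule B.toSubmodule := by
      refine ⟨disjoint_iff.2 ?_, codisjoint_iff.2 ?_⟩
      · exact congrArg Subrepresentation.toSubmodule (disjoint_iff.1 hAB.1)
      · exact congrArg Subrepresentation.toSubmodule (codisjoint_iff.1 hAB.2)
    have hA0' : A.toSubmodule ≠ ⊥ := fun h => hA0 (Subrepresentation.toSubmodule_injective h)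
    have hA1' : A.toSubmodule ≠ ⊤ := fun h => hA1 (Subrepresentation.toSubmodule_injective h)
    have hs := Submodule.finrank_add_eq_of_isCompl hc
    have h1 := Submodule.finrank_lt hA1'
    have h2 : 0 < Module.finrank ℂ A.toSubmodule := by
      rw [Nat.pos_iff_ne_zero]; intro h; exact hA0' (Submodule.finrank_eq_zero.1 h)
    have hch : ρ.character = A.toRepresentation.character + B.toRepresentation.character := by
      ext g
      let N : Bool → Submodule ℂ V := fun b => cond b A.toSubmodule B.toSubmodule
      have hN : DirectSum.IsInternal N :=
        (DirectSum.isInternal_submodule_iff_isCompl N (i := true) (j := false) (by simp)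
          (by ext b; cases b <;> simp)).2 hc
      have := LinearMap.trace_eq_sum_trace_restrict hN (f := ρ g)
        (fun b => by cases b; exacts [B.apply_mem_toSubmodule g, A.apply_mem_toSubmodule g])
      rw [Representation.character, this, Fintype.sum_bool]
      rfl
    rw [hch]
    exact add_mem (ih _ (by omega)) (ih _ (by omega))


lemma desc_four (t : ℕ) : ((t.descFactorial 4 : ℕ) : ℂ) = ((t : ℂ) ^ 2 - 3 * t + 1) ^ 2 - 1 := by
  match t with
  | 0 => simp [Nat.descFactorial]
  | 1 => norm_num [Nat.descFactorial]
  | 2 => norm_num [Nat.descFactorial]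
  | t + 3 =>
    simp only [Nat.descFactorial, Nat.add_sub_cancel, show t + 3 - 2 = t + 1 by omega,
      show t + 3 - 1 = t + 2 by omega, show t + 3 - 0 = t + 3 by omega]
    push_cast; ring

lemma desc_two (t : ℕ) : ((t.descFactorial 2 : ℕ) : ℂ) = (t : ℂ) ^ 2 - t := by
  match t with
  | 0 => simp [Nat.descFactorial]
  | t + 1 =>
    simp only [Nat.descFactorial, Nat.add_sub_cancel, show t + 1 - 0 = t + 1 by omega]
    push_cast; ring

section avg
variable {n : ℕ}

/-- inner product of functions on the symmetric group -/
noncomputable def ip (f h : Equiv.Perm (Fin n) → ℂ) : ℂ :=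
  (Nat.card (Equiv.Perm (Fin n)) : ℂ)⁻¹ * ∑ g, f g * h g⁻¹

/-- twist by the sign -/
noncomputable def tw (f : Equiv.Perm (Fin n) → ℂ) : Equiv.Perm (Fin n) → ℂ :=
  fun g => ((Equiv.Perm.sign g : ℤ) : ℂ) * f g

lemma ip_sum_right {I : Type*} (s : Finset I) (c : I → ℂ) (f : Equiv.Perm (Fin n) → ℂ)
    (h : I → Equiv.Perm (Fin n) → ℂ) :
    ip f (fun g => ∑ i ∈ s, c i * h i g) = ∑ i ∈ s, c i * ip f (h i) := by
  simp only [ip, Finset.mul_sum]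
  rw [Finset.sum_comm]
  refine Finset.sum_congr rfl fun i _ => Finset.sum_congr rfl fun g _ => by ring

lemma ip_sum_left {I : Type*} (s : Finset I) (c : I → ℂ) (f : Equiv.Perm (Fin n) → ℂ)
    (h : I → Equiv.Perm (Fin n) → ℂ) :
    ip (fun g => ∑ i ∈ s, c i * h i g) f = ∑ i ∈ s, c i * ip (h i) f := by
  simp only [ip, Finset.mul_sum, Finset.sum_mul]
  rw [Finset.sum_comm]
  refine Finset.sum_congr rfl fun i _ => Finset.sum_congr rfl fun g _ => by ring

lemma avg_desc {k : ℕ} (hk : k ≤ n) :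
    ∑ g : Equiv.Perm (Fin n), (((fixN g).descFactorial k : ℕ) : ℂ)
      = Nat.card (Equiv.Perm (Fin n)) := by
  exact_mod_cast congrArg (Nat.cast (R := ℂ)) (sum_desc hk)

lemma avg_sign_desc {k : ℕ} (hk : k + 2 ≤ n) :
    ∑ g : Equiv.Perm (Fin n), ((Equiv.Perm.sign g : ℤ) : ℂ) * (((fixN g).descFactorial k : ℕ) : ℂ)
      = 0 := by
  exact_mod_cast congrArg (Int.cast (R := ℂ)) (sum_sign_desc hk)

lemma cardG_ne : (Nat.card (Equiv.Perm (Fin n)) : ℂ) ≠ 0 := by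
  exact_mod_cast Nat.card_pos.ne'

/-- the standard character -/
noncomputable def u1 (n : ℕ) : Equiv.Perm (Fin n) → ℂ := fun g => (fixN g : ℂ) - 1

/-- the sum of the characters for (n-2,2) and (n-2,1,1) -/
noncomputable def u2 (n : ℕ) : Equiv.Perm (Fin n) → ℂ :=
  fun g => (fixN g : ℂ) ^ 2 - 3 * (fixN g : ℂ) + 1

lemma u1_ip (hn : 6 ≤ n) : ip (u1 n) (u1 n) = 1 := by
  have h0 := avg_desc (n := n) (k := 0) (by omega)
  have h1 := avg_desc (n := n) (k := 1) (by omega)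
  have h2 := avg_desc (n := n) (k := 2) (by omega)
  rw [ip, inv_mul_eq_one₀ cardG_ne]
  have : ∀ g : Equiv.Perm (Fin n), u1 n g * u1 n g⁻¹ = (((fixN g).descFactorial 2 : ℕ) : ℂ)
      - (((fixN g).descFactorial 1 : ℕ) : ℂ) + (((fixN g).descFactorial 0 : ℕ) : ℂ) := by
    intro g
    rw [desc_two, u1, u1, fixN_inv, Nat.descFactorial_one, Nat.descFactorial_zero]
    push_cast; ring
  simp_rw [this, Finset.sum_add_distrib, Finset.sum_sub_distrib, h0, h1, h2]
  ring

lemma u1_tw (hn : 6 ≤ n) : ip (u1 n) (tw (u1 n)) = 0 := by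
  have h0 := avg_sign_desc (n := n) (k := 0) (by omega)
  have h1 := avg_sign_desc (n := n) (k := 1) (by omega)
  have h2 := avg_sign_desc (n := n) (k := 2) (by omega)
  have : ∀ g : Equiv.Perm (Fin n), u1 n g * tw (u1 n) g⁻¹ =
      ((Equiv.Perm.sign g : ℤ) : ℂ) * (((fixN g).descFactorial 2 : ℕ) : ℂ)
      - ((Equiv.Perm.sign g : ℤ) : ℂ) * (((fixN g).descFactorial 1 : ℕ) : ℂ)
      + ((Equiv.Perm.sign g : ℤ) : ℂ) * (((fixN g).descFactorial 0 : ℕ) : ℂ) := by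
    intro g
    rw [desc_two, tw, u1, u1, fixN_inv, Equiv.Perm.sign_inv, Nat.descFactorial_one,
      Nat.descFactorial_zero]
    push_cast; ring
  simp_rw [ip, this, Finset.sum_add_distrib, Finset.sum_sub_distrib, h0, h1, h2]
  ring

lemma u2_ip (hn : 6 ≤ n) : ip (u2 n) (u2 n) = 2 := by
  have h0 := avg_desc (n := n) (k := 0) (by omega)
  have h4 := avg_desc (n := n) (k := 4) (by omega)
  rw [ip, inv_mul_eq_iff_eq_mul₀ cardG_ne]
  have : ∀ g : Equiv.Perm (Fin n), u2 n g * u2 n g⁻¹ = (((fixN g).descFactorial 4 : ℕ) : ℂ)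
      + (((fixN g).descFactorial 0 : ℕ) : ℂ) := by
    intro g
    rw [desc_four, u2, u2, fixN_inv, Nat.descFactorial_zero]
    push_cast; ring
  simp_rw [this, Finset.sum_add_distrib, h0, h4]
  ring

lemma u2_tw (hn : 6 ≤ n) : ip (u2 n) (tw (u2 n)) = 0 := by
  have h0 := avg_sign_desc (n := n) (k := 0) (by omega)
  have h4 := avg_sign_desc (n := n) (k := 4) (by omega)
  have : ∀ g : Equiv.Perm (Fin n), u2 n g * tw (u2 n) g⁻¹ =
      ((Equiv.Perm.sign g : ℤ) : ℂ) * (((fixN g).descFactorial 4 : ℕ) : ℂ)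
      + ((Equiv.Perm.sign g : ℤ) : ℂ) * (((fixN g).descFactorial 0 : ℕ) : ℂ) := by
    intro g
    rw [desc_four, tw, u2, u2, fixN_inv, Equiv.Perm.sign_inv, Nat.descFactorial_zero]
    push_cast; ring
  simp_rw [ip, this, Finset.sum_add_distrib, h0, h4]
  ring

lemma one_mem : (fun _ => 1 : Equiv.Perm (Fin n) → ℂ) ∈ virt (Equiv.Perm (Fin n)) := by
  have := char_mem_virt _ (Representation.trivial ℂ (Equiv.Perm (Fin n)) ℂ) le_rfl
  rwa [show Representation.character _ = _ from funext (triv_char n)] at this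

lemma fix_mem : (fun g => (fixN g : ℂ) : Equiv.Perm (Fin n) → ℂ) ∈ virt (Equiv.Perm (Fin n)) := by
  have := char_mem_virt _ (permRep n) le_rfl
  rwa [show Representation.character _ = _ from funext permRep_char] at this

lemma fix_sq_mem : (fun g => (fixN g : ℂ) * (fixN g : ℂ) : Equiv.Perm (Fin n) → ℂ)
    ∈ virt (Equiv.Perm (Fin n)) := by
  have := char_mem_virt _ ((permRep n).tprod (permRep n)) le_rfl
  rw [Representation.char_tensor, show Representation.character _ = _ from funext permRep_char] at this
  exact this

lemma u1_mem : u1 n ∈ virt (Equiv.Perm (Fin n)) := sub_mem fix_mem one_mem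

lemma u2_mem : u2 n ∈ virt (Equiv.Perm (Fin n)) := by
  have h := add_mem (sub_mem (fix_sq_mem (n := n)) (Submodule.smul_mem _ (3 : ℤ) fix_mem)) one_mem
  convert h using 1
  ext g
  simp [u2]; ring

end avg

lemma comb {I : Type*} [DecidableEq I] (τ : I → I) (hτ : ∀ i, τ (τ i) = i) (c : I →₀ ℤ) :
    (∑ i ∈ c.support, c i * c i = 1 → ∑ i ∈ c.support, c i * c (τ i) = 0 →
      ∃ i, c.support = {i} ∧ (c i = 1 ∨ c i = -1) ∧ τ i ≠ i) ∧
    (∑ i ∈ c.support, c i * c i = 2 → ∑ i ∈ c.support, c i * c (τ i) = 0 →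
      ∃ i j, i ≠ j ∧ c.support = {i, j} ∧ (c i = 1 ∨ c i = -1) ∧ (c j = 1 ∨ c j = -1) ∧
        τ i ≠ i ∧ τ j ≠ j) := by
  have key : ∀ m : ℤ, m ≤ 2 → ∑ i ∈ c.support, c i * c i = m →
      (∀ i ∈ c.support, c i = 1 ∨ c i = -1) ∧ (c.support.card : ℤ) = m := by
    intro m hm h
    have h1 : ∀ i ∈ c.support, c i = 1 ∨ c i = -1 := by
      intro i hi
      have h2 := Finset.single_le_sum (f := fun i => c i * c i) (fun j _ => mul_self_nonneg (c j)) hi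
      rw [h] at h2
      have h3 : c i ≠ 0 := Finsupp.mem_support_iff.1 hi
      have h4 : c i < 2 := by nlinarith
      have h5 : -2 < c i := by nlinarith
      omega
    refine ⟨h1, ?_⟩
    rw [← h, Finset.card_eq_sum_ones]
    push_cast
    refine Finset.sum_congr rfl fun i hi => ?_
    rcases h1 i hi with h | h <;> rw [h] <;> norm_num
  constructor
  · intro h h'
    obtain ⟨h1, h2⟩ := key 1 (by norm_num) h
    obtain ⟨i, hi⟩ := Finset.card_eq_one.1 (by exact_mod_cast h2 : c.support.card = 1)
    have := h1 i (by simp [hi])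
    refine ⟨i, hi, this, fun ht => ?_⟩
    rw [hi, Finset.sum_singleton, ht] at h'
    rcases this with h | h <;> rw [h] at h' <;> norm_num at h'
  · intro h h'
    obtain ⟨h1, h2⟩ := key 2 (by norm_num) h
    obtain ⟨i, j, hij, hs⟩ := Finset.card_eq_two.1 (by exact_mod_cast h2 : c.support.card = 2)
    have hi := h1 i (by simp [hs])
    have hj := h1 j (by simp [hs])
    have h0 : ∀ k, k ≠ i → k ≠ j → c k = 0 := by
      intro k hki hkj
      rw [← Finsupp.notMem_support_iff, hs]; simp [hki, hkj]
    rw [hs, Finset.sum_pair hij] at h'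
    have main : ∀ a b : I, a ≠ b → (c a = 1 ∨ c a = -1) → (c b = 1 ∨ c b = -1) →
        (∀ k, k ≠ a → k ≠ b → c k = 0) → c a * c (τ a) + c b * c (τ b) = 0 → τ a ≠ a := by
      intro a b hab ha hb h0 h ht
      have hne : τ b ≠ a := fun hh => hab (by rw [← ht, ← hh, hτ])
      rw [ht] at h
      by_cases hbb : τ b = b
      · rw [hbb] at h
        rcases ha with ha | ha <;> rcases hb with hb | hb <;> rw [ha, hb] at h <;> norm_num at h
      · rw [h0 _ hne hbb] at h
        rcases ha with ha | ha <;> rw [ha] at h <;> norm_num at h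
    refine ⟨i, j, hij, hs, hi, hj, main i j hij hi hj h0 h', main j i hij.symm hj hi
      (fun k a b => h0 k b a) (by rw [add_comm]; exact h')⟩

end PermAux

open PermAux

theorem exists_nonSelfConjugate_partition_character_ne_one
    (n : ℕ) (hn : 6 ≤ n)
    -- `X μ` is the irreducible character of the symmetric group `S_n` canonically labeled by
    -- the partition (Young diagram) `μ` of `n`; the canonical labeling is pinned down by the
    -- hypotheses: each `X μ` is an irreducible character, the labeling is a bijection onto the
    -- irreducible characters, and transposing the partition corresponds to twisting by sign.
    (X : YoungDiagram → Equiv.Perm (Fin n) → ℂ)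
    (hirr : ∀ μ : YoungDiagram, μ.card = n →
      ∃ V : FDRep ℂ (Equiv.Perm (Fin n)), Simple V ∧ V.character = X μ)
    (hinj : ∀ μ ν : YoungDiagram, μ.card = n → ν.card = n → X μ = X ν → μ = ν)
    (hsurj : ∀ V : FDRep ℂ (Equiv.Perm (Fin n)), Simple V →
      ∃ μ : YoungDiagram, μ.card = n ∧ V.character = X μ)
    (hconj : ∀ μ : YoungDiagram, μ.card = n →
      X μ.transpose = fun g => ((Equiv.Perm.sign g : ℤ) : ℂ) * X μ g)
    (x : Equiv.Perm (Fin n)) (hx : x ∈ alternatingGroup (Fin n)) :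
    ∃ μ : YoungDiagram, μ.card = n ∧ μ.transpose ≠ μ ∧ X μ x ≠ 1 ∧ X μ x ≠ -1 := by
  classical
  by_contra hcon
  have hcon' : ∀ μ : YoungDiagram, μ.card = n → μ.transpose ≠ μ → X μ x = 1 ∨ X μ x = -1 := by
    intro μ h1 h2
    by_contra h3
    rw [not_or] at h3
    exact hcon ⟨μ, h1, h2, h3.1, h3.2⟩
  let I := {μ : YoungDiagram // μ.card = n}
  let χ : I → Equiv.Perm (Fin n) → ℂ := fun i => X i.1
  have hct : ∀ μ : YoungDiagram, μ.transpose.card = μ.card := fun μ => by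
    simp [YoungDiagram.transpose, YoungDiagram.card]
  let τ : I → I := fun i => ⟨i.1.transpose, by rw [hct]; exact i.2⟩
  have hτ : ∀ i, τ (τ i) = i := fun i => Subtype.ext (YoungDiagram.transpose_transpose _)
  have hχτ : ∀ i, χ (τ i) = tw (χ i) := fun i => hconj i.1 i.2
  have hN : (Nat.card (Equiv.Perm (Fin n)) : ℂ) ≠ 0 := cardG_ne
  have := invertibleOfNonzero hN
  choose V hV hVc using fun i : I => hirr i.1 i.2
  have horth : ∀ i j, ip (χ i) (χ j) = if i = j then 1 else 0 := by
    intro i j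
    have := hV i
    have := hV j
    have h := FDRep.char_orthonormal (V i) (V j)
    rw [hVc, hVc] at h
    refine Eq.trans h ?_
    by_cases hij : i = j
    · subst hij
      rw [if_pos rfl, if_pos ⟨Iso.refl _⟩]
    · rw [if_neg hij, if_neg]
      rintro ⟨e⟩
      have h1 := FDRep.char_iso e
      rw [hVc, hVc] at h1
      exact hij (Subtype.ext (hinj _ _ i.2 j.2 h1))
  have hdec : ∀ u ∈ virt (Equiv.Perm (Fin n)), ∃ c : I →₀ ℤ,
      u = fun g => ∑ i ∈ c.support, (c i : ℂ) * χ i g := by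
    intro u hu
    have h1 : u ∈ Submodule.span ℤ (Set.range χ) := by
      refine Submodule.span_mono ?_ hu
      rintro f ⟨W, hW, rfl⟩
      obtain ⟨μ, hμ, h⟩ := hsurj W hW
      exact ⟨⟨μ, hμ⟩, h.symm⟩
    obtain ⟨c, hc⟩ := (Finsupp.mem_span_range_iff_exists_finsupp).1 h1
    refine ⟨c, ?_⟩
    rw [← hc]
    ext g
    simp [Finsupp.sum]
  have hip : ∀ (u : Equiv.Perm (Fin n) → ℂ) (c : I →₀ ℤ),
      (u = fun g => ∑ i ∈ c.support, (c i : ℂ) * χ i g) →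
      ip u u = ((∑ i ∈ c.support, c i * c i : ℤ) : ℂ) ∧
      ip u (tw u) = ((∑ i ∈ c.support, c i * c (τ i) : ℤ) : ℂ) := by
    intro u c hu
    have hco : ∀ j, ip u (χ j) = c j := by
      intro j
      rw [hu, ip_sum_left]
      simp_rw [horth]
      rw [Finset.sum_eq_single j]
      · rw [if_pos rfl, mul_one]
      · intro k _ hk
        rw [if_neg hk, mul_zero]
      · intro h
        rw [Finsupp.notMem_support_iff.1 h, Int.cast_zero, zero_mul]
    have htw : tw u = fun g => ∑ i ∈ c.support, (c i : ℂ) * χ (τ i) g := by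
      ext g
      simp_rw [hχτ, tw, hu, Finset.mul_sum]
      refine Finset.sum_congr rfl fun i _ => by ring
    constructor
    · conv_lhs => rw [show ip u u = ip u (fun g => ∑ i ∈ c.support, (c i : ℂ) * χ i g) from congrArg (ip u) hu]
      rw [ip_sum_right]
      simp_rw [hco]
      push_cast; rfl
    · rw [htw, ip_sum_right]
      simp_rw [hco]
      push_cast; rfl
  obtain ⟨c, hc⟩ := hdec _ u1_mem
  obtain ⟨h1, h2⟩ := hip _ c hc
  rw [u1_ip hn] at h1
  rw [u1_tw hn] at h2
  obtain ⟨i, hi, hci, hti⟩ := (comb τ hτ c).1 (by exact_mod_cast h1.symm) (by exact_mod_cast h2.symm)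
  obtain ⟨d, hd⟩ := hdec _ u2_mem
  obtain ⟨h3, h4⟩ := hip _ d hd
  rw [u2_ip hn] at h3
  rw [u2_tw hn] at h4
  obtain ⟨a, b, hab, hs, hda, hdb, hta, htb⟩ :=
    (comb τ hτ d).2 (by exact_mod_cast h3.symm) (by exact_mod_cast h4.symm)
  have hval : ∀ i, τ i ≠ i → χ i x = 1 ∨ χ i x = -1 := fun i h =>
    hcon' i.1 i.2 fun h' => h (Subtype.ext h')
  have e1 := congrFun hc x
  have e2 := congrFun hd x
  simp only [hi, Finset.sum_singleton, u1] at e1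
  simp only [hs, Finset.sum_pair hab, u2] at e2
  have ht : (fixN x : ℂ) = 0 ∨ (fixN x : ℂ) = 2 := by
    rcases hci with h | h <;> rcases hval i hti with h' | h' <;> rw [h, h'] at e1 <;>
      push_cast at e1
    · right; linear_combination e1
    · left; linear_combination e1
    · left; linear_combination e1
    · right; linear_combination e1
  rcases ht with ht | ht <;> rw [ht] at e2 <;> rcases hda with h5 | h5 <;> rw [h5] at e2 <;>
    rcases hdb with h6 | h6 <;> rw [h6] at e2 <;> rcases hval a hta with h7 | h7 <;>
    rw [h7] at e2 <;> rcases hval b htb with h8 | h8 <;> rw [h8] at e2 <;> norm_num at e2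
end
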